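/- The subgroup N = ⟨x², y²⟩ is a normal subgroup of Γ, N is isomorphic to ℤ × ℤ, and the quotient Γ/N is isomorphic to the infinite dihedral group, generated by the cosets xN and yN, each of which has order 2. -/

import Mathlib

/-- The relators of the Passman fours group:
`y⁻¹x²y·x²` and `x⁻¹y²x·y²` (i.e. `y⁻¹x²y = x⁻²` and `x⁻¹y²x = y⁻²`). -/
def foursRels : Set (FreeGroup (Fin 2)) :=
  { (FreeGroup.of 1)⁻¹ * (FreeGroup.of 0) ^ 2 * FreeGroup.of 1 * (FreeGroup.of 0) ^ 2,
    (FreeGroup.of 0)⁻¹ * (FreeGroup.of 1) ^ 2 * FreeGroup.of 0 * (FreeGroup.of 1) ^ 2 }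

/-- The Passman fours group `Γ = ⟨x, y ∣ y⁻¹x²y = x⁻², x⁻¹y²x = y⁻²⟩`. -/
abbrev Fours : Type := PresentedGroup foursRels

/-- The generator `x` of `Γ`. -/
def fx : Fours := PresentedGroup.of 0

/-- The generator `y` of `Γ`. -/
def fy : Fours := PresentedGroup.of 1

/-- `a = x²`. -/
def fa : Fours := fx ^ 2
/-- `b = y²`. -/
def fb : Fours := fy ^ 2
/-- `c = (xy)²`. -/
def fc : Fours := (fx * fy) ^ 2

/-- `N₁ = ⟨a, b⟩`. -/
def N₁ : Subgroup Fours := Subgroup.closure {fa, fb}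
/-- `N₂ = ⟨a, c⟩`. -/
def N₂ : Subgroup Fours := Subgroup.closure {fa, fc}
/-- `N₃ = ⟨b, c⟩`. -/
def N₃ : Subgroup Fours := Subgroup.closure {fb, fc}

lemma inv_fy_mul_fa_mul_fy : fy⁻¹ * fa * fy = fa⁻¹ := by
  rw [← mul_eq_one_iff_eq_inv]
  exact PresentedGroup.one_of_mem (rels := foursRels) (Or.inl rfl)

lemma inv_fx_mul_fb_mul_fx : fx⁻¹ * fb * fx = fb⁻¹ := by
  rw [← mul_eq_one_iff_eq_inv]
  exact PresentedGroup.one_of_mem (rels := foursRels) (Or.inr rfl)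

lemma semiconjBy_fy_fa : SemiconjBy fy fa fa⁻¹ := by
  have h : SemiconjBy fy fa⁻¹ fa := by
    rw [SemiconjBy, ← inv_fy_mul_fa_mul_fy]
    group
  simpa using h.inv_right

lemma semiconjBy_fx_fb : SemiconjBy fx fb fb⁻¹ := by
  have h : SemiconjBy fx fb⁻¹ fb := by
    rw [SemiconjBy, ← inv_fx_mul_fb_mul_fx]
    group
  simpa using h.inv_right

lemma commute_fa_fb : Commute fa fb := by
  have h : SemiconjBy (fy * fy) fa fa := by
    simpa using semiconjBy_fy_fa.inv_right.mul_left semiconjBy_fy_fa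
  rw [← pow_two] at h
  exact h.symm

lemma fours_closure_eq_top : Subgroup.closure {fx, fy} = ⊤ := by
  rw [eq_top_iff, ← PresentedGroup.closure_range_of foursRels, Subgroup.closure_le]
  rintro _ ⟨i, rfl⟩
  fin_cases i
  · exact Subgroup.subset_closure (Or.inl rfl)
  · exact Subgroup.subset_closure (Or.inr rfl)

lemma fa_mem_N₁ : fa ∈ N₁ := Subgroup.subset_closure (Or.inl rfl)

lemma fb_mem_N₁ : fb ∈ N₁ := Subgroup.subset_closure (Or.inr rfl)

/-- Conjugation by `g` preserves `N₁` as soon as it does so on the generators. -/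
lemma mul_mul_inv_mem_N₁ {g n : Fours} (ha : g * fa * g⁻¹ ∈ N₁) (hb : g * fb * g⁻¹ ∈ N₁)
    (hn : n ∈ N₁) : g * n * g⁻¹ ∈ N₁ := by
  have h : N₁ ≤ N₁.comap (MulAut.conj g).toMonoidHom := by
    refine (Subgroup.closure_le _).2 ?_
    rintro _ (rfl | rfl)
    exacts [ha, hb]
  exact h hn

lemma N₁_normal : N₁.Normal := by
  have hxa : fx * fa * fx⁻¹ = fa := by simp only [fa]; group
  have hxa' : fx⁻¹ * fa * fx⁻¹⁻¹ = fa := by simp only [fa]; group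
  have hyb : fy * fb * fy⁻¹ = fb := by simp only [fb]; group
  have hyb' : fy⁻¹ * fb * fy⁻¹⁻¹ = fb := by simp only [fb]; group
  have hxb : fx * fb * fx⁻¹ = fb⁻¹ := mul_inv_eq_of_eq_mul semiconjBy_fx_fb
  have hya : fy * fa * fy⁻¹ = fa⁻¹ := mul_inv_eq_of_eq_mul semiconjBy_fy_fa
  refine ⟨fun n hn g => ?_⟩
  have hg : g ∈ Subgroup.closure {fx, fy} := fours_closure_eq_top ▸ Subgroup.mem_top g
  induction hg using Subgroup.closure_induction'' generalizing n with
  | mem g hg =>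
    obtain rfl | rfl := hg
    · exact mul_mul_inv_mem_N₁ (hxa.symm ▸ fa_mem_N₁) (hxb.symm ▸ inv_mem fb_mem_N₁) hn
    · exact mul_mul_inv_mem_N₁ (hya.symm ▸ inv_mem fa_mem_N₁) (hyb.symm ▸ fb_mem_N₁) hn
  | inv_mem g hg =>
    obtain rfl | rfl := hg
    · refine mul_mul_inv_mem_N₁ (hxa'.symm ▸ fa_mem_N₁) ?_ hn
      rw [inv_inv, inv_fx_mul_fb_mul_fx]
      exact inv_mem fb_mem_N₁
    · refine mul_mul_inv_mem_N₁ ?_ (hyb'.symm ▸ fb_mem_N₁) hn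
      rw [inv_inv, inv_fy_mul_fa_mul_fy]
      exact inv_mem fa_mem_N₁
  | one => simpa using hn
  | mul g h _ _ ihg ihh =>
    simpa [mul_assoc] using ihg _ (ihh n hn)

/-- A pair of elements satisfying the defining relations of `Γ` induces a homomorphism on `Γ`. -/
def foursLift {G : Type*} [Group G] (u v : G) (huv : v⁻¹ * u ^ 2 * v * u ^ 2 = 1)
    (hvu : u⁻¹ * v ^ 2 * u * v ^ 2 = 1) : Fours →* G :=
  PresentedGroup.toGroup (f := ![u, v]) (rels := foursRels) <| by
    rintro _ (rfl | rfl)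
    · simpa using huv
    · simpa using hvu

section foursLift

variable {G : Type*} [Group G] {u v : G} (huv : v⁻¹ * u ^ 2 * v * u ^ 2 = 1)
  (hvu : u⁻¹ * v ^ 2 * u * v ^ 2 = 1)

@[simp]
lemma foursLift_fx : foursLift u v huv hvu fx = u := PresentedGroup.toGroup.of _

@[simp]
lemma foursLift_fy : foursLift u v huv hvu fy = v := PresentedGroup.toGroup.of _

end foursLift

/-- The glide reflection `(m, n) ↦ (m + 1, -n)` of `ℤ²`. -/
def glideX : Equiv.Perm (ℤ × ℤ) := (Equiv.addRight 1).prodCongr (Equiv.neg ℤ)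

/-- The glide reflection `(m, n) ↦ (-m, n + 1)` of `ℤ²`. -/
def glideY : Equiv.Perm (ℤ × ℤ) := (Equiv.neg ℤ).prodCongr (Equiv.addRight 1)

lemma glideX_sq : glideX ^ 2 = Equiv.addRight (2, 0) := by
  ext p <;> simp [glideX, pow_two]; ring

lemma glideY_sq : glideY ^ 2 = Equiv.addRight (0, 2) := by
  ext p <;> simp [glideY, pow_two]; ring

/-- The action of `Γ` on `ℤ²` by glide reflections. -/
def glideHom : Fours →* Equiv.Perm (ℤ × ℤ) :=
  foursLift glideX glideY
    (by
      rw [mul_assoc, mul_assoc, inv_mul_eq_one, glideX_sq]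
      ext p <;> simp [glideY])
    (by
      rw [mul_assoc, mul_assoc, inv_mul_eq_one, glideY_sq]
      ext p <;> simp [glideX])

lemma glideHom_fa_zpow_mul_fb_zpow (m n : ℤ) :
    glideHom (fa ^ m * fb ^ n) (0, 0) = (2 * m, 2 * n) := by
  have ha : glideHom fa = Equiv.addRight (2, 0) := by
    rw [fa, map_pow, glideHom, foursLift_fx, glideX_sq]
  have hb : glideHom fb = Equiv.addRight (0, 2) := by
    rw [fb, map_pow, glideHom, foursLift_fy, glideY_sq]
  simp [ha, hb, mul_comm]

/-- The homomorphism `(m, n) ↦ aᵐ bⁿ` from `ℤ × ℤ` to `Γ`. -/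
def latticeHom : Multiplicative (ℤ × ℤ) →* Fours where
  toFun p := fa ^ p.toAdd.1 * fb ^ p.toAdd.2
  map_one' := by simp
  map_mul' p q := by
    simp only [toAdd_mul, Prod.fst_add, Prod.snd_add, zpow_add]
    exact (commute_fa_fb.zpow_zpow _ _).mul_mul_mul_comm _ _

lemma latticeHom_injective : Function.Injective latticeHom := by
  intro p q h
  have h' := congrArg (fun g => glideHom g (0, 0)) h
  simp only [latticeHom, MonoidHom.coe_mk, OneHom.coe_mk, glideHom_fa_zpow_mul_fb_zpow,
    Prod.mk.injEq] at h'
  refine Multiplicative.toAdd.injective (Prod.ext ?_ ?_) <;> omega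

lemma latticeHom_range : latticeHom.range = N₁ := by
  refine le_antisymm ?_ ((Subgroup.closure_le _).2 ?_)
  · rintro _ ⟨p, rfl⟩
    exact mul_mem (zpow_mem fa_mem_N₁ _) (zpow_mem fb_mem_N₁ _)
  · rintro _ (rfl | rfl)
    · exact ⟨.ofAdd (1, 0), by simp [latticeHom]⟩
    · exact ⟨.ofAdd (0, 1), by simp [latticeHom]⟩

/-- Two elements `u`, `v` with `u² = v² = 1` induce a homomorphism on the infinite dihedral group
sending the reflections `sr 0` and `sr 1` to `u` and `v`. -/
def dihedralLift {G : Type*} [Group G] (u v : G) (hu : u ^ 2 = 1) (hv : v ^ 2 = 1) :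
    DihedralGroup 0 →* G :=
  have hu' : u⁻¹ = u := inv_eq_of_mul_eq_one_left (by rw [← pow_two, hu])
  have hv' : v⁻¹ = v := inv_eq_of_mul_eq_one_left (by rw [← pow_two, hv])
  have conj (k : ℤ) : (u * v) ^ k * u = u * (u * v) ^ (-k) := by
    have h : SemiconjBy u (u * v)⁻¹ (u * v) := by
      rw [SemiconjBy, mul_inv_rev, hu', hv', mul_assoc]
    rw [← (h.zpow_right k).eq, inv_zpow']
  have r_sr (i j : ℤ) : u * (u * v) ^ (j - i) = (u * v) ^ i * (u * (u * v) ^ j) := by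
    rw [← mul_assoc, conj, mul_assoc, ← zpow_add, neg_add_eq_sub]
  have sr_r (i j : ℤ) : u * (u * v) ^ (i + j) = u * (u * v) ^ i * (u * v) ^ j := by
    rw [zpow_add, mul_assoc]
  have sr_sr (i j : ℤ) : (u * v) ^ (j - i) = u * (u * v) ^ i * (u * (u * v) ^ j) := by
    rw [mul_assoc, ← r_sr, ← mul_assoc, ← pow_two, hu, one_mul]
  MonoidHom.mk'
    (fun
      | .r k => (u * v) ^ (show ℤ from k)
      | .sr k => u * (u * v) ^ (show ℤ from k))
    (by
      rintro (i | i) (j | j)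
      exacts [zpow_add (u * v) (show ℤ from i) (show ℤ from j), r_sr i j, sr_r i j, sr_sr i j])

section dihedralLift

variable {G : Type*} [Group G] {u v : G} (hu : u ^ 2 = 1) (hv : v ^ 2 = 1)

lemma dihedralLift_sr_zero : dihedralLift u v hu hv (.sr 0) = u := by
  change u * (u * v) ^ (0 : ℤ) = u
  simp

lemma dihedralLift_sr_one : dihedralLift u v hu hv (.sr 1) = v := by
  change u * (u * v) ^ (1 : ℤ) = v
  rw [zpow_one, ← mul_assoc, ← pow_two, hu, one_mul]

end dihedralLift

lemma dihedral_closure_sr_eq_top :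
    Subgroup.closure {DihedralGroup.sr 0, DihedralGroup.sr 1} =
      (⊤ : Subgroup (DihedralGroup 0)) := by
  set H := Subgroup.closure {DihedralGroup.sr 0, (DihedralGroup.sr 1 : DihedralGroup 0)}
  have h0 : DihedralGroup.sr 0 ∈ H := Subgroup.subset_closure (Or.inl rfl)
  have h1 : DihedralGroup.sr 1 ∈ H := Subgroup.subset_closure (Or.inr rfl)
  have hr (k : ZMod 0) : DihedralGroup.r k ∈ H := by
    have h := zpow_mem (mul_mem h0 h1) (show ℤ from k)
    rw [DihedralGroup.sr_mul_sr, DihedralGroup.r_zpow, sub_zero, one_mul] at h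
    exact h
  refine eq_top_iff.2 ?_
  rintro (k | k) -
  · exact hr k
  · simpa using mul_mem h0 (hr k)

/-- The homomorphism from `Γ` to the infinite dihedral group sending `x` and `y` to reflections. -/
def dihedralHom : Fours →* DihedralGroup 0 :=
  foursLift (.sr 0) (.sr 1) (by simp [pow_two]) (by simp [pow_two])

@[simp]
lemma dihedralHom_fx : dihedralHom fx = .sr 0 := foursLift_fx _ _

@[simp]
lemma dihedralHom_fy : dihedralHom fy = .sr 1 := foursLift_fy _ _

lemma dihedralHom_surjective : Function.Surjective dihedralHom := by
  rw [← MonoidHom.range_eq_top, eq_top_iff, ← dihedral_closure_sr_eq_top, Subgroup.closure_le]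
  rintro _ (rfl | rfl)
  exacts [⟨fx, dihedralHom_fx⟩, ⟨fy, dihedralHom_fy⟩]

lemma dihedralHom_ker : dihedralHom.ker = N₁ := by
  have := N₁_normal
  refine le_antisymm (fun g hg => ?_) ((Subgroup.closure_le _).2 ?_)
  · have hx : (QuotientGroup.mk' N₁ fx) ^ 2 = 1 := (QuotientGroup.eq_one_iff fa).2 fa_mem_N₁
    have hy : (QuotientGroup.mk' N₁ fy) ^ 2 = 1 := (QuotientGroup.eq_one_iff fb).2 fb_mem_N₁
    have h : (dihedralLift _ _ hx hy).comp dihedralHom = QuotientGroup.mk' N₁ := by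
      refine MonoidHom.eq_of_eqOn_dense fours_closure_eq_top ?_
      rintro _ (rfl | rfl)
      · simp only [MonoidHom.comp_apply, dihedralHom_fx, dihedralLift_sr_zero]
      · simp only [MonoidHom.comp_apply, dihedralHom_fy, dihedralLift_sr_one]
    have hg' := DFunLike.congr_fun h g
    rw [MonoidHom.comp_apply, MonoidHom.mem_ker.1 hg, map_one] at hg'
    exact (QuotientGroup.eq_one_iff g).1 hg'.symm
  · rintro _ (rfl | rfl)
    · simp [fa, pow_two, MonoidHom.mem_ker]
    · simp [fb, pow_two, MonoidHom.mem_ker]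

/-- The subgroup `N = ⟨x², y²⟩` is normal in `Γ`, is isomorphic to `ℤ × ℤ`, and the
quotient `Γ/N` is infinite dihedral, generated by the cosets of `x` and `y`, each of
order `2`. (The quotient isomorphism is expressed via a surjective homomorphism
`φ : Γ → D∞` with kernel `N`.) -/
theorem N_normal_free_abelian_dihedral_quotient :
    N₁.Normal ∧
    Nonempty (↥N₁ ≃* Multiplicative (ℤ × ℤ)) ∧
    (∃ φ : Fours →* DihedralGroup 0, Function.Surjective φ ∧ φ.ker = N₁ ∧
      orderOf (φ fx) = 2 ∧ orderOf (φ fy) = 2 ∧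
      Subgroup.closure {φ fx, φ fy} = ⊤) := by
  refine ⟨N₁_normal, ⟨?_⟩, dihedralHom, dihedralHom_surjective, dihedralHom_ker, ?_, ?_, ?_⟩
  · exact ((MonoidHom.ofInjective latticeHom_injective).trans
      (MulEquiv.subgroupCongr latticeHom_range)).symm
  · rw [dihedralHom_fx, DihedralGroup.orderOf_sr]
  · rw [dihedralHom_fy, DihedralGroup.orderOf_sr]
  · rw [dihedralHom_fx, dihedralHom_fy, dihedral_closure_sr_eq_top]
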